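/- Let n ≥ 40 and let D be an S_{3,1}-free oriented graph on n vertices with exactly ⌊(n+2)²/4⌋ arcs. Then the vertex set of D admits a partition V(D) = X ∪ Y such that: (i) |X| ∈ {⌊n/2⌋ − 1, ⌈n/2⌉ − 1}; (ii) x→y is an arc for every x ∈ X and y ∈ Y; (iii) there are no arcs between two vertices of X, and the subdigraph induced on Y is in-degree 2-regular (every y ∈ Y has exactly two in-neighbors inside Y); moreover these are all the arcs of D. -/

import Mathlib

/-- An oriented graph on `V`: an arc relation in which no two vertices are
joined by arcs in both directions (in particular it is irreflexive). -/
def IsOriented {V : Type*} (A : V → V → Prop) : Prop :=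
  ∀ u v : V, A u v → ¬ A v u

/-- The in-degree of `v`: the number of in-neighbours of `v`. -/
noncomputable def inDeg {V : Type*} (A : V → V → Prop) (v : V) : ℕ :=
  {u : V | A u v}.ncard

/-- The number of arcs of the digraph. -/
noncomputable def arcCount {V : Type*} (A : V → V → Prop) : ℕ :=
  {p : V × V | A p.1 p.2}.ncard

/-- A copy of `S_{k,1}` (the 1-subdivision of the in-star of order `k+1`)
centered at `v`: pairwise distinct vertices `v, u 0, …, u (k-1), w 0, …, w (k-1)`
with arcs `w i → u i` and `u i → v`. -/
def HasSCopyAt {V : Type*} (A : V → V → Prop) (k : ℕ) (v : V) : Prop :=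
  ∃ u w : Fin k → V,
    Function.Injective u ∧ Function.Injective w ∧
    (∀ i j : Fin k, u i ≠ w j) ∧
    (∀ i : Fin k, u i ≠ v) ∧ (∀ i : Fin k, w i ≠ v) ∧
    (∀ i : Fin k, A (w i) (u i)) ∧ (∀ i : Fin k, A (u i) v)

/-- `A` is `S_{k,1}`-free: no copy of `S_{k,1}` with any center. -/
def SFree {V : Type*} (A : V → V → Prop) (k : ℕ) : Prop :=
  ∀ v : V, ¬ HasSCopyAt A k v


namespace S31
open Finset Classical

section matching
variable {V : Type*}

def Dj (p q : V × V) : Prop := p.1 ≠ q.1 ∧ p.1 ≠ q.2 ∧ p.2 ≠ q.1 ∧ p.2 ≠ q.2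

noncomputable def star (E : Finset (V × V)) (c : V) : Finset (V × V) :=
  E.filter (fun e => e.1 = c ∨ e.2 = c)

noncomputable def oth (c : V) (e : V × V) : V := if e.1 = c then e.2 else e.1

lemma oth_inj (E : Finset (V × V)) (hE : ∀ e ∈ E, (e.2, e.1) ∉ E) (c : V) :
    Set.InjOn (oth c) (star E c : Set (V × V)) := by
  rintro ⟨a, b⟩ h1 ⟨a', b'⟩ h2 h
  simp only [star, coe_filter, Set.mem_ofPred_eq] at h1 h2
  have h3 := hE _ h1.1
  have h4 := hE _ h2.1
  simp only [oth] at h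
  split_ifs at h with h5 h6 h6
  · simp_all
  · rcases h2 with ⟨h2, h7 | h7⟩
    · exact absurd h7 h6
    · exfalso; apply h3; simp only at *; subst h h5 h7; exact h2
  · rcases h1 with ⟨h1, h7 | h7⟩
    · exact absurd h7 h5
    · exfalso; apply h3; simp only at *; subst h h6 h7; exact h2.1
  · have := h1.2.resolve_left h5
    have := h2.2.resolve_left h6
    simp_all

lemma star_card_le (E : Finset (V × V)) (hE : ∀ e ∈ E, (e.2, e.1) ∉ E) (S : Finset V)
    (hS : ∀ e ∈ E, e.1 ∈ S ∧ e.2 ∈ S) (c : V) : (star E c).card + 1 ≤ S.card ∨ star E c = ∅ := by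
  by_cases h0 : star E c = ∅
  · exact Or.inr h0
  left
  have hc : c ∈ S := by
    obtain ⟨e, he⟩ := Finset.nonempty_iff_ne_empty.mpr h0
    simp only [star, mem_filter] at he
    have := hS e he.1
    rcases he.2 with h | h
    · exact h ▸ this.1
    · exact h ▸ this.2
  have : (star E c).card ≤ (S.erase c).card := by
    apply Finset.card_le_card_of_injOn (oth c) _ (oth_inj E hE c)
    rintro ⟨a, b⟩ he
    simp only [star, coe_filter, Set.mem_ofPred_eq] at he
    have h1 := hS _ he.1
    have h2 := hE _ he.1
    simp only [coe_erase, Set.mem_sdiff, mem_coe, Set.mem_singleton_iff, oth]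
    split_ifs with h
    · refine ⟨h1.2, ?_⟩
      intro h3
      simp only at *
      subst h
      subst h3
      exact h2 he.1
    · exact ⟨h1.1, h⟩
  rw [Finset.card_erase_of_mem hc] at this
  have : 0 < S.card := Finset.card_pos.mpr ⟨c, hc⟩
  omega

lemma star_avoid (E : Finset (V × V)) (hE : ∀ e ∈ E, (e.2, e.1) ∉ E) (c : V)
    (F : Finset V) (hF : F.card < (star E c).card) : ∃ e ∈ star E c, oth c e ∉ F := by
  by_contra! h
  have := Finset.card_le_card_of_injOn (oth c) h (oth_inj E hE c)
  omega

lemma dj_of_oth (E : Finset (V × V)) (c : V) (e : V × V) (he : e ∈ star E c) (q : V × V)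
    (hc1 : q.1 ≠ c) (hc2 : q.2 ≠ c) (h1 : oth c e ≠ q.1) (h2 : oth c e ≠ q.2) : Dj e q := by
  obtain ⟨a, b⟩ := e
  simp only [star, mem_filter] at he
  simp only [oth] at h1 h2
  unfold Dj
  split_ifs at h1 h2 with h
  · simp only at *
    subst h
    exact ⟨hc1.symm, hc2.symm, h1, h2⟩
  · have := he.2.resolve_left h
    simp only at *
    subst this
    exact ⟨h1, h2, hc1.symm, hc2.symm⟩

lemma cover_two (E : Finset (V × V)) (q : V × V)
    (h : ∀ e ∈ E, ¬ Dj e q) : E ⊆ star E q.1 ∪ star E q.2 := by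
  intro e he
  have := h e he
  simp only [star, mem_union, mem_filter]
  unfold Dj at this
  tauto

lemma nu1 (E : Finset (V × V)) (hE : ∀ e ∈ E, (e.2, e.1) ∉ E) (S : Finset V)
    (hS : ∀ e ∈ E, e.1 ∈ S ∧ e.2 ∈ S)
    (h : ∀ e ∈ E, ∀ q ∈ E, ¬ Dj e q) (hl : 5 ≤ S.card) : E.card + 1 ≤ S.card := by
  by_cases hc : ∃ c, 3 ≤ (star E c).card
  · obtain ⟨c, hc⟩ := hc
    have : E ⊆ star E c := by
      intro q hq
      by_contra hn
      have hq' : ¬ (q.1 = c ∨ q.2 = c) := by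
        intro h'; exact hn (by simp only [star, mem_filter]; exact ⟨hq, h'⟩)
      push Not at hq'
      obtain ⟨e, he, ho⟩ := star_avoid E hE c {q.1, q.2}
        (lt_of_le_of_lt Finset.card_le_two (by omega))
      simp only [mem_insert, mem_singleton, not_or] at ho
      exact h e (Finset.mem_filter.mp he).1 q hq (dj_of_oth E c e he q hq'.1 hq'.2 ho.1 ho.2)
    have h1 := Finset.card_le_card this
    rcases star_card_le E hE S hS c with h2 | h2
    · omega
    · rw [h2] at hc; simp at hc
  · push Not at hc
    rcases E.eq_empty_or_nonempty with h0 | ⟨q, hq⟩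
    · rw [h0, Finset.card_empty]; omega
    · have h1 := Finset.card_le_card (cover_two E q (fun e he => h e he q hq))
      have h2 := Finset.card_union_le (star E q.1) (star E q.2)
      have := hc q.1
      have := hc q.2
      omega

lemma nu2 (E : Finset (V × V)) (hE : ∀ e ∈ E, (e.2, e.1) ∉ E) (S : Finset V)
    (hS : ∀ e ∈ E, e.1 ∈ S ∧ e.2 ∈ S)
    (h : ∀ e ∈ E, ∀ q ∈ E, ∀ r ∈ E, Dj e q → Dj e r → Dj q r → False) (hl : 9 ≤ S.card) :
    E.card + 2 ≤ 2 * S.card := by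
  by_cases hc : ∃ c, 5 ≤ (star E c).card
  · obtain ⟨c, hc⟩ := hc
    have h1 : (E \ star E c).card + 1 ≤ S.card := by
      apply nu1
      · intro e he hh
        exact hE e (mem_sdiff.mp he).1 (mem_sdiff.mp hh).1
      · intro e he
        exact hS e (mem_sdiff.mp he).1
      · intro q hq r hr hd
        simp only [star, mem_sdiff, mem_filter, not_and, not_or] at hq hr
        have hq2 := hq.2 hq.1
        have hr2 := hr.2 hr.1
        obtain ⟨e, he, ho⟩ := star_avoid E hE c {q.1, q.2, r.1, r.2}
          (lt_of_le_of_lt Finset.card_le_four (by omega))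
        simp only [mem_insert, mem_singleton, not_or] at ho
        exact h e (Finset.mem_filter.mp he).1 q hq.1 r hr.1
          (dj_of_oth E c e he q hq2.1 hq2.2 ho.1 ho.2.1)
          (dj_of_oth E c e he r hr2.1 hr2.2 ho.2.2.1 ho.2.2.2) hd
      · omega
    have h2 := Finset.card_sdiff_add_card_eq_card (s := star E c) (t := E) (Finset.filter_subset _ _)
    rcases star_card_le E hE S hS c with h3 | h3
    · omega
    · rw [h3] at hc; simp at hc
  · push Not at hc
    by_cases hd : ∃ q ∈ E, ∃ r ∈ E, Dj q r
    · obtain ⟨q, hq, r, hr, hd⟩ := hd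
      have h1 : E ⊆ (star E q.1 ∪ star E q.2) ∪ (star E r.1 ∪ star E r.2) := by
        intro e he
        by_contra hn
        simp only [star, mem_union, mem_filter] at hn
        refine h e he q hq r hr ?_ ?_ hd <;> unfold Dj <;> tauto
      have h2 := Finset.card_le_card h1
      have h3 := Finset.card_union_le (star E q.1 ∪ star E q.2) (star E r.1 ∪ star E r.2)
      have h4 := Finset.card_union_le (star E q.1) (star E q.2)
      have h5 := Finset.card_union_le (star E r.1) (star E r.2)
      have := hc q.1
      have := hc q.2
      have := hc r.1
      have := hc r.2
      omega
    · push Not at hd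
      have := nu1 E hE S hS hd (by omega)
      omega

end matching

section graph
variable {V : Type*} [Fintype V] (A : V → V → Prop)

noncomputable def dg (v : V) : ℕ := (univ.filter (fun u => A u v)).card
noncomputable def Lo : Finset V := univ.filter (fun v => dg A v ≤ 4)
noncomputable def Hi : Finset V := univ.filter (fun v => ¬ dg A v ≤ 4)
noncomputable def pp (h : V) : ℕ := ((Hi A).filter (fun u => A u h)).card
noncomputable def zz (l : V) : ℕ := ((Hi A).filter (fun h => ¬ A l h)).card
noncomputable def dL (l : V) : ℕ := ((Lo A).filter (fun u => A u l)).card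
noncomputable def ex (l : V) : ℕ := dg A l - zz A l
noncomputable def Bd : Finset V := (Lo A).filter (fun l => 1 ≤ ex A l)

variable {A}

lemma mem_Lo {v : V} : v ∈ Lo A ↔ dg A v ≤ 4 := by simp [Lo]
lemma mem_Hi {v : V} : v ∈ Hi A ↔ 5 ≤ dg A v := by simp [Hi]; omega
lemma Lo_ne_Hi {u v : V} (hu : u ∈ Lo A) (hv : v ∈ Hi A) : u ≠ v := by
  rintro rfl
  rw [mem_Lo] at hu
  rw [mem_Hi] at hv
  omega

lemma card_LH : (Lo A).card + (Hi A).card = Fintype.card V := by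
  unfold Lo Hi
  rw [Finset.card_filter_add_card_filter_not]
  rfl

lemma dg_split (v : V) : dg A v = dL A v + pp A v := by
  unfold dg dL pp
  rw [← Finset.card_filter_add_card_filter_not (s := univ.filter (fun u => A u v))
    (p := fun u => dg A u ≤ 4)]
  unfold Lo Hi
  congr 1 <;> congr 1 <;> ext u <;> simp [and_comm]

lemma zz_ge (hori : IsOriented A) (l : V) : pp A l ≤ zz A l := by
  apply Finset.card_le_card
  intro h
  simp only [mem_filter]
  exact fun ⟨h1, h2⟩ => ⟨h1, hori _ _ h2⟩

lemma ex_le_dL (hori : IsOriented A) (l : V) : ex A l ≤ dL A l := by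
  have := zz_ge hori l
  have := dg_split (A := A) l
  unfold ex
  omega

lemma no3 (hori : IsOriented A) (hfree : SFree A 3) (v u1 u2 u3 w1 w2 w3 : V)
    (a1 : A u1 v) (a2 : A u2 v) (a3 : A u3 v) (b1 : A w1 u1) (b2 : A w2 u2) (b3 : A w3 u3)
    (u12 : u1 ≠ u2) (u13 : u1 ≠ u3) (u23 : u2 ≠ u3)
    (w12 : w1 ≠ w2) (w13 : w1 ≠ w3) (w23 : w2 ≠ w3)
    (c12 : u1 ≠ w2) (c13 : u1 ≠ w3) (c21 : u2 ≠ w1) (c23 : u2 ≠ w3) (c31 : u3 ≠ w1)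
    (c32 : u3 ≠ w2) : False := by
  have irr : ∀ x y, A x y → x ≠ y := by
    rintro x y h rfl; exact hori _ _ h h
  have d : ∀ x y, A x y → A y v → x ≠ v := by
    rintro x y h h' rfl; exact hori _ _ h h'
  apply hfree v
  refine ⟨![u1, u2, u3], ![w1, w2, w3], ?_, ?_, ?_, ?_, ?_, ?_, ?_⟩
  · intro i j hij
    fin_cases i <;> fin_cases j <;> simp_all
  · intro i j hij
    fin_cases i <;> fin_cases j <;> simp_all
  · have e1 := (irr _ _ b1).symm
    have e2 := (irr _ _ b2).symm
    have e3 := (irr _ _ b3).symm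
    intro i j
    fin_cases i <;> fin_cases j <;> simp <;> assumption
  · have e1 := irr _ _ a1
    have e2 := irr _ _ a2
    have e3 := irr _ _ a3
    intro i
    fin_cases i <;> simp <;> assumption
  · have e1 := d _ _ b1 a1
    have e2 := d _ _ b2 a2
    have e3 := d _ _ b3 a3
    intro i
    fin_cases i <;> simp <;> assumption
  · intro i
    fin_cases i <;> simp <;> assumption
  · intro i
    fin_cases i <;> simp <;> assumption

/-- Pick an in-neighbour outside a small set. -/
lemma pick {v : V} (F : Finset V) (hF : F.card < dg A v) : ∃ w, A w v ∧ w ∉ F := by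
  by_contra! h
  have : dg A v ≤ F.card := by
    apply Finset.card_le_card
    intro w hw
    exact h w (by simpa using hw)
  omega

lemma pick4 {v : V} (hv : v ∈ Hi A) (a b c d : V) :
    ∃ w, A w v ∧ w ≠ a ∧ w ≠ b ∧ w ≠ c ∧ w ≠ d := by
  rw [mem_Hi] at hv
  obtain ⟨w, h1, h2⟩ := pick (A := A) (v := v) {a, b, c, d}
    (lt_of_le_of_lt Finset.card_le_four (by omega))
  simp only [mem_insert, mem_singleton, not_or] at h2
  exact ⟨w, h1, h2⟩

/-- At most two high in-neighbours. -/
lemma pp_le (hori : IsOriented A) (hfree : SFree A 3) (h : V) : pp A h ≤ 2 := by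
  by_contra! hn
  obtain ⟨a, b, c, ha, hb, hc, hab, hac, hbc⟩ := Finset.two_lt_card_iff.mp hn
  simp only [mem_filter] at ha hb hc
  obtain ⟨x, hx, hx1, hx2, -⟩ := pick4 ha.1 b c c c
  obtain ⟨y, hy, hy1, hy2, hy3, -⟩ := pick4 hb.1 a c x x
  obtain ⟨w, hw, hw1, hw2, hw3, hw4⟩ := pick4 hc.1 a b x y
  exact no3 hori hfree h a b c x y w ha.2 hb.2 hc.2 hx hy hw hab hac hbc hy3.symm hw3.symm
    hw4.symm hy1.symm hw1.symm hx1.symm hw2.symm hx2.symm hy2.symm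

/-- Two high in-neighbours exclude a further arc. -/
lemma N0' (hori : IsOriented A) (hfree : SFree A 3) (h a b u w : V) (ha : a ∈ Hi A) (hb : b ∈ Hi A)
    (hab : a ≠ b) (hah : A a h) (hbh : A b h) (huh : A u h) (hwu : A w u)
    (hua : u ≠ a) (hub : u ≠ b) (hwa : w ≠ a) (hwb : w ≠ b) : False := by
  obtain ⟨x, hx, hx1, hx2, hx3, -⟩ := pick4 ha b u w w
  obtain ⟨y, hy, hy1, hy2, hy3, hy4⟩ := pick4 hb a u w x
  exact no3 hori hfree h a b u x y w hah hbh huh hx hy hwu hab hua.symm hub.symm hy4.symm hx3 hy3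
    hy1.symm hwa.symm hx1.symm hwb.symm hx2.symm hy2.symm

lemma N0 (hori : IsOriented A) (hfree : SFree A 3) (h u w : V) (hp : 2 ≤ pp A h)
    (hu : u ∈ Lo A) (hw : w ∈ Lo A) (huh : A u h) (hwu : A w u) : False := by
  obtain ⟨a, b, ha, hb, hab⟩ := Finset.one_lt_card_iff.mp (show 1 < pp A h by omega)
  simp only [mem_filter] at ha hb
  exact N0' hori hfree h a b u w ha.1 hb.1 hab ha.2 hb.2 huh hwu (Lo_ne_Hi hu ha.1)
    (Lo_ne_Hi hu hb.1) (Lo_ne_Hi hw ha.1) (Lo_ne_Hi hw hb.1)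

lemma N1 (hori : IsOriented A) (hfree : SFree A 3) (h u w u' w' : V) (hp : 1 ≤ pp A h)
    (hu : u ∈ Lo A) (hw : w ∈ Lo A) (hu' : u' ∈ Lo A) (hw' : w' ∈ Lo A)
    (huh : A u h) (hwu : A w u) (huh' : A u' h) (hwu' : A w' u') (hd : Dj (w, u) (w', u')) :
    False := by
  obtain ⟨a, ha⟩ := Finset.card_pos.mp (show 0 < pp A h by omega)
  simp only [mem_filter] at ha
  obtain ⟨x, hx, hx1, hx2, hx3, hx4⟩ := pick4 ha.1 u w u' w'
  obtain ⟨d1, d2, d3, d4⟩ := hd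
  simp only at d1 d2 d3 d4
  exact no3 hori hfree h a u u' x w w' ha.2 huh huh' hx hwu hwu' (Lo_ne_Hi hu ha.1).symm
    (Lo_ne_Hi hu' ha.1).symm d4 hx2 hx4 d1 (Lo_ne_Hi hw ha.1).symm (Lo_ne_Hi hw' ha.1).symm
    hx1.symm d3 hx3.symm d2.symm

lemma mem_Bd {l : V} : l ∈ Bd A ↔ l ∈ Lo A ∧ 1 ≤ ex A l := by simp [Bd]

lemma Bd_zz {l : V} (hl : l ∈ Bd A) : ex A l + zz A l ≤ 4 := by
  rw [mem_Bd, mem_Lo] at hl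
  unfold ex at *
  omega

/-- three bad vertices have a common out-neighbour in `Hi` if it is large -/
lemma common3 (hh : 10 ≤ (Hi A).card) {a b c : V} (ha : a ∈ Bd A) (hb : b ∈ Bd A) (hc : c ∈ Bd A) :
    ∃ h, A a h ∧ A b h ∧ A c h := by
  by_contra! hn
  have h1 : Hi A ⊆ ((Hi A).filter (fun h => ¬ A a h) ∪ (Hi A).filter (fun h => ¬ A b h)) ∪
      (Hi A).filter (fun h => ¬ A c h) := by
    intro h hm
    have := hn h
    simp only [mem_union, mem_filter]
    tauto
  have h2 := Finset.card_le_card h1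
  have h3 := Finset.card_union_le ((Hi A).filter (fun h => ¬ A a h) ∪ (Hi A).filter (fun h => ¬ A b h))
      ((Hi A).filter (fun h => ¬ A c h))
  have h4 := Finset.card_union_le ((Hi A).filter (fun h => ¬ A a h)) ((Hi A).filter (fun h => ¬ A b h))
  have ea := Bd_zz ha
  have eb := Bd_zz hb
  have ec := Bd_zz hc
  rw [mem_Bd] at ha hb hc
  unfold zz at *
  omega

lemma common2 (K : Finset V) (hK : K ⊆ Hi A) (hh : 7 ≤ K.card) {a b : V}
    (ha : a ∈ Bd A) (hb : b ∈ Bd A) : ∃ h ∈ K, A a h ∧ A b h := by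
  by_contra! hn
  have h1 : K ⊆ ((Hi A).filter (fun h => ¬ A a h) ∪ (Hi A).filter (fun h => ¬ A b h)) := by
    intro h hm
    have := hn h hm
    have := hK hm
    simp only [mem_union, mem_filter]
    tauto
  have h2 := Finset.card_le_card h1
  have h4 := Finset.card_union_le ((Hi A).filter (fun h => ¬ A a h)) ((Hi A).filter (fun h => ¬ A b h))
  have ea := Bd_zz ha
  have eb := Bd_zz hb
  rw [mem_Bd] at ha hb
  unfold zz at *
  omega

/-- no three disjoint arcs into bad vertices -/
lemma nuB (hori : IsOriented A) (hfree : SFree A 3) (hh : 10 ≤ (Hi A).card)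
    (e q r : V × V) (he : A e.1 e.2) (hq : A q.1 q.2) (hr : A r.1 r.2)
    (he' : e.2 ∈ Bd A) (hq' : q.2 ∈ Bd A) (hr' : r.2 ∈ Bd A)
    (d1 : Dj e q) (d2 : Dj e r) (d3 : Dj q r) : False := by
  obtain ⟨h, h1, h2, h3⟩ := common3 hh he' hq' hr'
  obtain ⟨a1, a2, a3, a4⟩ := d1
  obtain ⟨b1, b2, b3, b4⟩ := d2
  obtain ⟨c1, c2, c3, c4⟩ := d3
  exact no3 hori hfree h e.2 q.2 r.2 e.1 q.1 r.1 h1 h2 h3 he hq hr a4 b4 c4 a1 b1 c1 a3 b3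
    a2.symm c3 b2.symm c2.symm

/-- Two vertices with two low in-neighbours each give two disjoint arcs. -/
lemma two_two (hori : IsOriented A) (a b : V) (hab : a ≠ b) (ha : 2 ≤ dL A a) (hb : 2 ≤ dL A b) :
    ∃ x y, x ∈ Lo A ∧ y ∈ Lo A ∧ A x a ∧ A y b ∧ Dj (x, a) (y, b) := by
  have key : ∀ a b : V, a ≠ b → 2 ≤ dL A a → 2 ≤ dL A b → ¬ A b a →
      ∃ x y, x ∈ Lo A ∧ y ∈ Lo A ∧ A x a ∧ A y b ∧ x ≠ y ∧ x ≠ b ∧ y ≠ a := by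
    intro a b hab ha hb hn
    obtain ⟨y, hy, hya⟩ := Finset.exists_mem_ne (show 1 < dL A b by omega) a
    obtain ⟨x, hx, hxy⟩ := Finset.exists_mem_ne (show 1 < dL A a by omega) y
    simp only [mem_filter] at hx hy
    refine ⟨x, y, hx.1, hy.1, hx.2, hy.2, hxy, ?_, hya⟩
    rintro rfl
    exact hn hx.2
  by_cases h : A b a
  · obtain ⟨x, y, h1, h2, h3, h4, h5, h6, h7⟩ := key b a hab.symm hb ha (hori _ _ h)
    exact ⟨y, x, h2, h1, h4, h3, h5.symm, h7, h6.symm, hab⟩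
  · obtain ⟨x, y, h1, h2, h3, h4, h5, h6, h7⟩ := key a b hab ha hb h
    exact ⟨x, y, h1, h2, h3, h4, h5, h6, h7.symm, hab⟩

lemma triple_ord (hori : IsOriented A) (hfree : SFree A 3) (hh : 10 ≤ (Hi A).card)
    (a b c : V) (ha : a ∈ Bd A) (hb : b ∈ Bd A) (hc : c ∈ Bd A) (hab : a ≠ b) (hac : a ≠ c)
    (hbc : b ≠ c) (da : 3 ≤ dg A a) (db : 3 ≤ dg A b) (dc : 3 ≤ dg A c)
    (n1 : ¬ A a c) (n2 : ¬ A b c) (n3 : ¬ A a b) : False := by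
  obtain ⟨x, hx, hx'⟩ := pick (A := A) (v := a) {b, c} (lt_of_le_of_lt Finset.card_le_two (by omega))
  obtain ⟨y, hy, hy'⟩ := pick (A := A) (v := b) {c, x} (lt_of_le_of_lt Finset.card_le_two (by omega))
  obtain ⟨w, hw, hw'⟩ := pick (A := A) (v := c) {x, y} (lt_of_le_of_lt Finset.card_le_two (by omega))
  simp only [mem_insert, mem_singleton, not_or] at hx' hy' hw'
  have hya : y ≠ a := by rintro rfl; exact n3 hy
  have hwa : w ≠ a := by rintro rfl; exact n1 hw
  have hwb : w ≠ b := by rintro rfl; exact n2 hw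
  refine nuB hori hfree hh (x, a) (y, b) (w, c) hx hy hw ha hb hc ?_ ?_ ?_
  · exact ⟨Ne.symm hy'.2, hx'.1, hya.symm, hab⟩
  · exact ⟨Ne.symm hw'.1, hx'.2, hwa.symm, hac⟩
  · exact ⟨Ne.symm hw'.2, hy'.1, hwb.symm, hbc⟩

lemma cyc_prop {p q r s t u : Prop} (o1 : p → ¬ q) (o2 : r → ¬ s) (o3 : t → ¬ u)
    (t1 : ¬ r → ¬ t → ¬ p → False) (t2 : ¬ p → ¬ u → ¬ r → False)
    (t3 : ¬ t → ¬ r → ¬ q → False) (t4 : ¬ q → ¬ s → ¬ t → False)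
    (t5 : ¬ u → ¬ p → ¬ s → False) (t6 : ¬ s → ¬ q → ¬ u → False) :
    (p ∧ t ∧ s) ∨ (q ∧ u ∧ r) := by
  by_cases q1 : p <;> by_cases q2 : q <;> by_cases q3 : r <;> by_cases q4 : s <;>
      by_cases q5 : t <;> by_cases q6 : u <;> simp_all

lemma S_card (hori : IsOriented A) (hfree : SFree A 3) (hh : 10 ≤ (Hi A).card) :
    ((Bd A).filter (fun l => 3 ≤ dg A l)).card ≤ 3 := by
  by_contra! hn
  have T : ∀ a ∈ (Bd A).filter (fun l => 3 ≤ dg A l), ∀ b ∈ (Bd A).filter (fun l => 3 ≤ dg A l),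
      ∀ c ∈ (Bd A).filter (fun l => 3 ≤ dg A l), a ≠ b → a ≠ c → b ≠ c →
      (A a b ∧ A b c ∧ A c a) ∨ (A b a ∧ A c b ∧ A a c) := by
    intro a ha b hb c hc hab hac hbc
    simp only [mem_filter] at ha hb hc
    have o1 := hori a b
    have o2 := hori a c
    have o3 := hori b c
    have t1 := triple_ord hori hfree hh a b c ha.1 hb.1 hc.1 hab hac hbc ha.2 hb.2 hc.2
    have t2 := triple_ord hori hfree hh a c b ha.1 hc.1 hb.1 hac hab hbc.symm ha.2 hc.2 hb.2
    have t3 := triple_ord hori hfree hh b a c hb.1 ha.1 hc.1 hab.symm hbc hac hb.2 ha.2 hc.2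
    have t4 := triple_ord hori hfree hh b c a hb.1 hc.1 ha.1 hbc hab.symm hac.symm hb.2 hc.2 ha.2
    have t5 := triple_ord hori hfree hh c a b hc.1 ha.1 hb.1 hac.symm hbc.symm hab hc.2 ha.2 hb.2
    have t6 := triple_ord hori hfree hh c b a hc.1 hb.1 ha.1 hbc.symm hac.symm hab.symm hc.2 hb.2 ha.2
    exact cyc_prop o1 o2 o3 t1 t2 t3 t4 t5 t6
  obtain ⟨U, hU, hUc⟩ := Finset.exists_subset_card_eq (show 4 ≤ _ from hn)
  obtain ⟨a, b, c, d, hab, hac, had, hbc, hbd, hcd, rfl⟩ := Finset.card_eq_four.mp hUc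
  have ha := hU (show a ∈ _ by simp)
  have hb := hU (show b ∈ _ by simp)
  have hc := hU (show c ∈ _ by simp)
  have hd := hU (show d ∈ _ by simp)
  have t1 := T a ha b hb c hc hab hac hbc
  have t2 := T a ha b hb d hd hab had hbd
  have t3 := T b hb c hc d hd hbc hbd hcd
  clear T hU hn ha hb hc hd
  have o1 := hori a b
  have o2 := hori b c
  have o3 := hori b d
  rcases t1 with ⟨p1, p2, p3⟩ | ⟨p1, p2, p3⟩ <;> rcases t2 with ⟨q1, q2, q3⟩ | ⟨q1, q2, q3⟩ <;>
    rcases t3 with ⟨r1, r2, r3⟩ | ⟨r1, r2, r3⟩ <;>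
    first
    | exact o1 p1 q1
    | exact o1 q1 p1
    | exact o2 p2 r1
    | exact o2 r1 p2
    | exact o3 q2 r3
    | exact o3 r3 q2

lemma count_prod (S T : Finset V) :
    ((S ×ˢ T).filter (fun e => A e.1 e.2)).card = ∑ t ∈ T, (S.filter (fun s => A s t)).card := by
  simp only [Finset.card_filter]
  rw [Finset.sum_product_right]

lemma arcCount_eq : arcCount A = ∑ v, dg A v := by
  unfold arcCount dg
  rw [← count_prod, Set.ncard_eq_toFinset_card']
  congr 1
  ext e
  simp

lemma cross : ∑ h ∈ Hi A, dL A h + ∑ l ∈ Lo A, zz A l = (Hi A).card * (Lo A).card := by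
  have h1 : ∑ h ∈ Hi A, dL A h = ∑ l ∈ Lo A, ((Hi A).filter (fun h => A l h)).card := by
    unfold dL
    simp only [Finset.card_filter]
    rw [Finset.sum_comm]
  rw [h1, ← Finset.sum_add_distrib]
  unfold zz
  simp only [Finset.card_filter_add_card_filter_not]
  simp [mul_comm]

lemma total : arcCount A + ∑ l ∈ Lo A, zz A l =
    ∑ h ∈ Hi A, pp A h + (Hi A).card * (Lo A).card + ∑ l ∈ Lo A, dg A l := by
  have h1 : ∑ v, dg A v = ∑ l ∈ Lo A, dg A l + ∑ h ∈ Hi A, dg A h := by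
    unfold Lo Hi
    rw [Finset.sum_filter_add_sum_filter_not]
  have h2 : ∑ h ∈ Hi A, dg A h = ∑ h ∈ Hi A, dL A h + ∑ h ∈ Hi A, pp A h := by
    rw [← Finset.sum_add_distrib]
    exact Finset.sum_congr rfl (fun h _ => dg_split h)
  have := cross (A := A)
  rw [arcCount_eq, h1, h2]
  omega

lemma total_le : arcCount A ≤
    ∑ h ∈ Hi A, pp A h + (Hi A).card * (Lo A).card + ∑ l ∈ Bd A, ex A l := by
  have h1 : ∑ l ∈ Bd A, ex A l = ∑ l ∈ Lo A, ex A l := by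
    unfold Bd
    apply Finset.sum_filter_of_ne
    intro x _ hx
    omega
  have h2 : ∑ l ∈ Lo A, dg A l ≤ ∑ l ∈ Lo A, ex A l + ∑ l ∈ Lo A, zz A l := by
    rw [← Finset.sum_add_distrib]
    apply Finset.sum_le_sum
    intro l _
    unfold ex
    omega
  have := total (A := A)
  omega

lemma Bd_sub : Bd A ⊆ Lo A := Finset.filter_subset _ _

lemma Bd_has (hori : IsOriented A) {l : V} (hl : l ∈ Bd A) : ∃ w ∈ Lo A, A w l := by
  have h1 := ex_le_dL hori l
  rw [mem_Bd] at hl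
  obtain ⟨w, hw⟩ := Finset.card_pos.mp (show 0 < dL A l by omega)
  simp only [mem_filter] at hw
  exact ⟨w, hw⟩

variable (A) in
noncomputable def P2 : Finset V := (Hi A).filter (fun h => 2 ≤ pp A h)
variable (A) in
noncomputable def K1 : Finset V := (Hi A).filter (fun h => 1 ≤ pp A h)

lemma sum_pp (hori : IsOriented A) (hfree : SFree A 3) :
    ∑ h ∈ Hi A, pp A h = (K1 A).card + (P2 A).card := by
  unfold K1 P2
  simp only [Finset.card_filter]
  rw [← Finset.sum_add_distrib]
  apply Finset.sum_congr rfl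
  intro h _
  have := pp_le hori hfree h
  split_ifs <;> omega

lemma P2_le_zz (hori : IsOriented A) (hfree : SFree A 3) {l : V} (hl : l ∈ Bd A) :
    (P2 A).card ≤ zz A l := by
  apply Finset.card_le_card
  intro h hh
  simp only [P2, mem_filter] at hh ⊢
  refine ⟨hh.1, fun hlh => ?_⟩
  obtain ⟨w, hw, hwl⟩ := Bd_has hori hl
  exact N0 hori hfree h l w hh.2 (Bd_sub hl) hw hlh hwl

lemma Bd_small (hori : IsOriented A) (hfree : SFree A 3) (h : V) (hh : h ∈ P2 A) :
    (Bd A).card + 3 ≤ (Lo A).card := by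
  simp only [P2, mem_filter] at hh
  have h1 : Disjoint (Bd A) ((Lo A).filter (fun u => A u h)) := by
    rw [Finset.disjoint_left]
    intro l hl hl'
    simp only [mem_filter] at hl'
    obtain ⟨w, hw, hwl⟩ := Bd_has hori hl
    exact N0 hori hfree h l w hh.2 (Bd_sub hl) hw hl'.2 hwl
  have h2 : Bd A ∪ (Lo A).filter (fun u => A u h) ⊆ Lo A :=
    Finset.union_subset Bd_sub (Finset.filter_subset _ _)
  have h3 := Finset.card_le_card h2
  rw [Finset.card_union_of_disjoint h1] at h3
  have h4 := dg_split (A := A) h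
  have h5 := pp_le hori hfree h
  have h6 := mem_Hi.mp hh.1
  change _ + dL A h ≤ _ at h3
  omega

variable (A) in
noncomputable def EB : Finset (V × V) := ((Lo A) ×ˢ (Bd A)).filter (fun e => A e.1 e.2)

lemma mem_EB {e : V × V} : e ∈ EB A ↔ (e.1 ∈ Lo A ∧ e.2 ∈ Bd A) ∧ A e.1 e.2 := by
  simp [EB]

lemma X_le_EB (hori : IsOriented A) : ∑ l ∈ Bd A, ex A l ≤ (EB A).card := by
  unfold EB
  rw [count_prod]
  exact Finset.sum_le_sum (fun l _ => ex_le_dL hori l)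

lemma X_le2 (hori : IsOriented A) (hfree : SFree A 3) (hh : 10 ≤ (Hi A).card)
    (hl : 9 ≤ (Lo A).card) : ∑ l ∈ Bd A, ex A l + 2 ≤ 2 * (Lo A).card := by
  have h1 := X_le_EB hori
  have h2 := nu2 (EB A) (fun e he hh => hori _ _ (mem_EB.mp he).2 (mem_EB.mp hh).2) (Lo A)
    (fun e he => ⟨(mem_EB.mp he).1.1, Bd_sub (mem_EB.mp he).1.2⟩)
    (fun e he q hq r hr => by
      rw [mem_EB] at he hq hr
      exact nuB hori hfree hh e q r he.2 hq.2 hr.2 he.1.2 hq.1.2 hr.1.2) hl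
  omega

lemma EB1 (hori : IsOriented A) (hfree : SFree A 3) (hk : 7 ≤ (K1 A).card) :
    ∀ e ∈ EB A, ∀ q ∈ EB A, ¬ Dj e q := by
  intro e he q hq hd
  rw [mem_EB] at he hq
  obtain ⟨h, hK, h1, h2⟩ := common2 (K1 A) (Finset.filter_subset _ _) hk he.1.2 hq.1.2
  exact N1 hori hfree h e.2 e.1 q.2 q.1 (Finset.mem_filter.mp hK).2 (Bd_sub he.1.2) he.1.1
    (Bd_sub hq.1.2) hq.1.1 h1 he.2 h2 hq.2 hd

lemma X_le1 (hori : IsOriented A) (hfree : SFree A 3) (hk : 7 ≤ (K1 A).card)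
    (hl : 5 ≤ (Lo A).card) : ∑ l ∈ Bd A, ex A l + 1 ≤ (Lo A).card := by
  have h1 := X_le_EB hori
  have h2 := nu1 (EB A) (fun e he hh => hori _ _ (mem_EB.mp he).2 (mem_EB.mp hh).2) (Lo A)
    (fun e he => ⟨(mem_EB.mp he).1.1, Bd_sub (mem_EB.mp he).1.2⟩)
    (EB1 hori hfree hk) hl
  omega

lemma X_leA1 (hori : IsOriented A) (hfree : SFree A 3) (hk : 7 ≤ (K1 A).card)
    (hb : (Bd A).Nonempty) (hp : (P2 A).Nonempty) :
    ∑ l ∈ Bd A, ex A l + (P2 A).card ≤ (Lo A).card := by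
  obtain ⟨h, hh⟩ := hp
  have hsm := Bd_small hori hfree h hh
  have hP : ∀ l ∈ Bd A, ex A l + (P2 A).card ≤ 4 := by
    intro l hl
    have := P2_le_zz hori hfree hl
    have := Bd_zz hl
    omega
  by_cases h2 : ∃ l ∈ Bd A, 2 ≤ ex A l
  · obtain ⟨l, hl, hl2⟩ := h2
    have h3 : ∀ m ∈ (Bd A).erase l, ex A m ≤ 1 := by
      intro m hm
      rw [mem_erase] at hm
      by_contra! hn
      obtain ⟨x, y, hx, hy, hxl, hym, hd⟩ := two_two hori l m (Ne.symm hm.1)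
        (le_trans hl2 (ex_le_dL hori l)) (le_trans hn (ex_le_dL hori m))
      exact EB1 hori hfree hk (x, l) (mem_EB.mpr ⟨⟨hx, hl⟩, hxl⟩) (y, m)
        (mem_EB.mpr ⟨⟨hy, hm.2⟩, hym⟩) hd
    have h4 : ∑ m ∈ (Bd A).erase l, ex A m ≤ _ := Finset.sum_le_card_nsmul _ _ _ h3
    have h5 := Finset.add_sum_erase (Bd A) (ex A) hl
    have h6 := Finset.card_erase_add_one hl
    have := hP l hl
    simp only [smul_eq_mul, mul_one] at h4
    omega
  · push Not at h2
    have h4 : ∑ l ∈ Bd A, ex A l ≤ _ := Finset.sum_le_card_nsmul (Bd A) (ex A) 1 (fun l hl => by have := h2 l hl; omega)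
    obtain ⟨l, hl⟩ := hb
    have := hP l hl
    rw [mem_Bd] at hl
    simp only [smul_eq_mul, mul_one] at h4
    omega

lemma X_leB1 (hori : IsOriented A) (hfree : SFree A 3) (hh : 10 ≤ (Hi A).card)
    (hk : (K1 A).Nonempty) : ∑ l ∈ Bd A, ex A l ≤ (Lo A).card + 9 := by
  obtain ⟨h, hK⟩ := hk
  simp only [K1, mem_filter] at hK
  have h1 : ((Bd A).filter (fun l => 2 ≤ ex A l ∧ A l h)).card ≤ 1 := by
    rw [Finset.card_le_one]
    intro a ha b hb
    simp only [mem_filter] at ha hb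
    by_contra hab
    obtain ⟨x, y, hx, hy, hxl, hym, hd⟩ := two_two hori a b hab
        (le_trans ha.2.1 (ex_le_dL hori a)) (le_trans hb.2.1 (ex_le_dL hori b))
    exact N1 hori hfree h a x b y hK.2 (Bd_sub ha.1) hx (Bd_sub hb.1) hy ha.2.2 hxl hb.2.2 hym hd
  have h2 := S_card hori hfree hh
  have h3 : ∑ l ∈ Bd A, ex A l ≤ ∑ l ∈ Bd A, (1 + 3 * (if 2 ≤ ex A l ∧ A l h then 1 else 0) +
      2 * (if 3 ≤ dg A l then 1 else 0)) := by
    apply Finset.sum_le_sum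
    intro l hl
    have e1 := Bd_zz hl
    by_cases hA : A l h
    · by_cases h2 : 2 ≤ ex A l
      · simp only [h2, hA, and_self, if_true]; omega
      · omega
    · have e2 : 0 < zz A l := Finset.card_pos.mpr ⟨h, by simp [hK.1, hA]⟩
      by_cases h2 : 2 ≤ ex A l
      · have : 3 ≤ dg A l := by unfold ex at h2; omega
        simp only [this, if_true]; omega
      · omega
  rw [Finset.sum_add_distrib, Finset.sum_add_distrib, ← Finset.mul_sum, ← Finset.mul_sum,
    ← Finset.card_filter, ← Finset.card_filter] at h3
  have h4 := Finset.card_le_card (Bd_sub (A := A))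
  simp only [sum_const, smul_eq_mul, mul_one] at h3
  omega

lemma four_le (n a : ℕ) (ha : a = (n + 2) ^ 2 / 4) : (n + 2) ^ 2 ≤ 4 * a + 3 := by omega

lemma four_le' (n a : ℕ) (ha : a = (n + 2) ^ 2 / 4) : (n + 2) ^ 2 ≤ 4 * a + 1 := by
  have h1 := four_le n a ha
  have h2 : 4 * a ≤ (n + 2) ^ 2 := by omega
  rcases Nat.even_or_odd' n with ⟨k, rfl | rfl⟩
  · ring_nf at *; omega
  · ring_nf at *; omega

/-- sizes of both classes -/
lemma sizes (hori : IsOriented A) (hfree : SFree A 3) (n : ℕ) (hn : 40 ≤ n)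
    (hcard : Fintype.card V = n) (harcs : arcCount A = (n + 2) ^ 2 / 4) :
    10 ≤ (Hi A).card ∧ 9 ≤ (Lo A).card := by
  have h1 := total_le (A := A)
  have h2 := four_le' n _ harcs
  have h3 := card_LH (A := A)
  rw [hcard] at h3
  have h4 : ∑ l ∈ Hi A, pp A l ≤ _ := Finset.sum_le_card_nsmul (Hi A) (pp A) 2 (fun l _ => pp_le hori hfree l)
  have h5 : ∑ l ∈ Bd A, ex A l ≤ _ := Finset.sum_le_card_nsmul (Bd A) (ex A) 4 (fun l hl => by have := Bd_zz hl; omega)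
  have h6 := Finset.card_le_card (Bd_sub (A := A))
  simp only [smul_eq_mul] at h4 h5
  have h7 : arcCount A ≤ 2 * (Hi A).card + (Hi A).card * (Lo A).card + 4 * (Lo A).card := by omega
  generalize (Hi A).card = h at *
  generalize (Lo A).card = l at *
  generalize arcCount A = a at *
  constructor
  · by_contra! hc
    interval_cases h <;> nlinarith
  · by_contra! hc
    interval_cases l <;> nlinarith

lemma Bd_empty (hori : IsOriented A) (hfree : SFree A 3) (n : ℕ) (hn : 40 ≤ n)
    (hcard : Fintype.card V = n) (harcs : arcCount A = (n + 2) ^ 2 / 4) : Bd A = ∅ := by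
  by_contra hne
  have hb := Finset.nonempty_iff_ne_empty.mpr hne
  obtain ⟨hh, hl⟩ := sizes hori hfree n hn hcard harcs
  have h1 := total_le (A := A)
  rw [sum_pp hori hfree] at h1
  have h2 := four_le' n _ harcs
  have h3 := card_LH (A := A)
  rw [hcard] at h3
  have hKH : (K1 A).card ≤ (Hi A).card := Finset.card_le_card (Finset.filter_subset _ _)
  have hP3 : (P2 A).card ≤ 3 := by
    obtain ⟨l, hl⟩ := hb
    have := P2_le_zz hori hfree hl
    have := Bd_zz hl
    rw [mem_Bd] at hl
    omega
  by_cases hK : 7 ≤ (K1 A).card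
  · have hX : ∑ l ∈ Bd A, ex A l + (P2 A).card ≤ (Lo A).card := by
      rcases (P2 A).eq_empty_or_nonempty with hp | hp
      · have := X_le1 hori hfree hK (by omega)
        rw [hp, Finset.card_empty]
        omega
      · exact X_leA1 hori hfree hK hb hp
    have h7 : arcCount A ≤ (Hi A).card + (Hi A).card * (Lo A).card + (Lo A).card := by omega
    generalize (Hi A).card = h at *
    generalize (Lo A).card = l at *
    generalize arcCount A = a at *
    subst h3
    zify at *
    nlinarith [sq_nonneg ((h : ℤ) - l)]
  · by_cases hK0 : (K1 A).card + (P2 A).card ≤ 1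
    · have := X_le2 hori hfree hh hl
      have h7 : arcCount A + 1 ≤ (Hi A).card * (Lo A).card + 2 * (Lo A).card := by omega
      generalize (Hi A).card = h at *
      generalize (Lo A).card = l at *
      generalize arcCount A = a at *
      subst h3
      zify at *
      nlinarith [sq_nonneg ((h : ℤ) + 2 - l)]
    · have hKn : (K1 A).Nonempty := by
        rw [Finset.nonempty_iff_ne_empty]
        intro h0
        have : P2 A ⊆ K1 A := by
          intro x hx
          simp only [P2, K1, mem_filter] at *
          exact ⟨hx.1, by omega⟩
        rw [h0] at this
        rw [h0, Finset.subset_empty.mp this] at hK0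
        simp at hK0
      have := X_leB1 hori hfree hh hKn
      have h7 : arcCount A ≤ (Hi A).card * (Lo A).card + (Lo A).card + 18 := by omega
      generalize (Hi A).card = h at *
      generalize (Lo A).card = l at *
      generalize arcCount A = a at *
      by_cases hl20 : 20 ≤ l
      · subst h3
        zify at *
        nlinarith [sq_nonneg ((h : ℤ) + 2 - l)]
      · have : 40 ≤ l + h := by omega
        subst h3
        push Not at hl20
        interval_cases l <;> nlinarith

end graph

end S31

open S31

/-- structure of the extremal `S_{3,1}`-free oriented graphs on
`n ≥ 40` vertices with exactly `⌊(n+2)²/4⌋` arcs.  (In ℕ, `⌊n/2⌋ - 1 = n/2 - 1`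
and `⌈n/2⌉ - 1 = (n+1)/2 - 1`.) -/
theorem extremal_S31_structure {V : Type*} [Fintype V] (A : V → V → Prop)
    (n : ℕ) (hn : 40 ≤ n) (hcard : Fintype.card V = n)
    (hori : IsOriented A) (hfree : SFree A 3)
    (harcs : arcCount A = (n + 2) ^ 2 / 4) :
    ∃ X Y : Set V,
      X ∪ Y = Set.univ ∧ Disjoint X Y ∧
      (X.ncard = n / 2 - 1 ∨ X.ncard = (n + 1) / 2 - 1) ∧
      (∀ x ∈ X, ∀ y ∈ Y, A x y) ∧
      (∀ x ∈ X, ∀ x' ∈ X, ¬ A x x') ∧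
      (∀ y ∈ Y, {z : V | z ∈ Y ∧ A z y}.ncard = 2) ∧
      (∀ u v : V, A u v → (u ∈ X ∧ v ∈ Y) ∨ (u ∈ Y ∧ v ∈ Y)) := by
  classical
  have hB := Bd_empty hori hfree n hn hcard harcs
  obtain ⟨hh, hl⟩ := sizes hori hfree n hn hcard harcs
  have htot := total (A := A)
  have h2 := four_le' n _ harcs
  have h3 := card_LH (A := A)
  rw [hcard] at h3
  have hdz : ∀ l ∈ Lo A, dg A l ≤ zz A l := by
    intro l hl
    by_contra! hc
    have : l ∈ Bd A := mem_Bd.mpr ⟨hl, by unfold ex; omega⟩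
    rw [hB] at this
    simp at this
  have hs1 := Finset.sum_le_sum hdz
  have hpp : ∀ h ∈ Hi A, pp A h ≤ 2 := fun h _ => pp_le hori hfree h
  have hs2 := Finset.sum_le_sum hpp
  have hs3 : ∑ h ∈ Hi A, 2 = 2 * (Hi A).card := by simp [mul_comm]
  -- the product bound
  have hprod : 4 * ((Hi A).card * ((Lo A).card + 2)) ≤ (n + 2) ^ 2 := by
    rw [← h3]
    zify
    nlinarith [sq_nonneg (((Hi A).card : ℤ) - (Lo A).card - 2)]
  have hprod' : (Hi A).card * ((Lo A).card + 2) ≤ arcCount A := by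
    rw [harcs]
    omega
  rw [mul_add] at hprod'
  have e1 : ∑ l ∈ Lo A, dg A l = ∑ l ∈ Lo A, zz A l := by omega
  have e2 : ∑ h ∈ Hi A, pp A h = ∑ h ∈ Hi A, 2 := by omega
  have e3 : (Hi A).card * ((Lo A).card + 2) = arcCount A := by rw [mul_add]; omega
  have f1 := (Finset.sum_eq_sum_iff_of_le hdz).mp e1
  have f2 := (Finset.sum_eq_sum_iff_of_le hpp).mp e2
  -- each low vertex has an out-neighbour in the high class
  have hout : ∀ l ∈ Lo A, ∃ h ∈ Hi A, A l h := by
    intro l hl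
    by_contra! hc
    have : zz A l = (Hi A).card := by
      unfold zz
      rw [Finset.filter_true_of_mem hc]
    have := f1 l hl
    have := mem_Lo.mp hl
    omega
  have noLL : ∀ w ∈ Lo A, ∀ l ∈ Lo A, ¬ A w l := by
    intro w hw l hl hwl
    obtain ⟨h, hh, hlh⟩ := hout l hl
    exact N0 hori hfree h l w (f2 h hh).ge hl hw hlh hwl
  have hzero : ∀ l ∈ Lo A, zz A l = 0 := by
    intro l hl
    have hdl : dL A l = 0 := by
      unfold dL
      rw [Finset.card_eq_zero, Finset.filter_eq_empty_iff]
      exact fun w hw => noLL w hw l hl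
    have hdp : pp A l = zz A l := by
      rw [← f1 l hl, dg_split, hdl, zero_add]
    -- non-out-neighbours are in-neighbours
    have hsub : (Hi A).filter (fun h => A h l) = (Hi A).filter (fun h => ¬ A l h) := by
      apply Finset.eq_of_subset_of_card_le
      · intro h
        simp only [Finset.mem_filter]
        exact fun ⟨h1, h2⟩ => ⟨h1, hori _ _ h2⟩
      · exact hdp.ge
    by_contra hz
    obtain ⟨x, hx⟩ := Finset.card_pos.mp (Nat.pos_of_ne_zero hz)
    have hdom : ∀ y ∈ (Hi A).filter (fun h => ¬ A l h), ∀ h ∈ Hi A, A l h → A y h := by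
      intro y hy h hhH hlh
      rw [← hsub, Finset.mem_filter] at hy
      by_contra hn
      obtain ⟨a, b, ha, hb, hab⟩ := Finset.one_lt_card_iff.mp
        (show 1 < pp A h by have := f2 h hhH; omega)
      simp only [Finset.mem_filter] at ha hb
      refine N0' hori hfree h a b l y ha.1 hb.1 hab ha.2 hb.2 hlh hy.2 (Lo_ne_Hi hl ha.1)
        (Lo_ne_Hi hl hb.1) ?_ ?_
      · rintro rfl; exact hn ha.2
      · rintro rfl; exact hn hb.2
    obtain ⟨h, hhH, hlh⟩ := hout l hl
    have hz2 : zz A l ≤ pp A h := by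
      apply Finset.card_le_card
      intro y hy
      exact Finset.mem_filter.mpr ⟨(Finset.mem_filter.mp hy).1, hdom y hy h hhH hlh⟩
    have hx2 : pp A x ≤ (((Hi A).filter (fun h => ¬ A l h)).erase x).card := by
      apply Finset.card_le_card
      intro y hy
      simp only [Finset.mem_filter] at hy
      rw [Finset.mem_erase, Finset.mem_filter]
      refine ⟨?_, hy.1, ?_⟩
      · rintro rfl; exact hori _ _ hy.2 hy.2
      · intro hly
        exact hori _ _ hy.2 (hdom x hx y hy.1 hly)
    have hx3 := Finset.card_erase_add_one hx
    have hx4 := f2 x (Finset.mem_filter.mp hx).1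
    have hx5 := f2 h hhH
    change _ = zz A l at hx3
    omega
  have hLH : ∀ l ∈ Lo A, ∀ h ∈ Hi A, A l h := by
    intro l hl h hh
    by_contra hn
    have := hzero l hl
    unfold zz at this
    rw [Finset.card_eq_zero, Finset.filter_eq_empty_iff] at this
    exact this hh hn
  have hcl : ∀ v, v ∈ Lo A ∨ v ∈ Hi A := by
    intro v
    rw [mem_Lo, mem_Hi]
    omega
  refine ⟨(Lo A : Set V), (Hi A : Set V), ?_, ?_, ?_, ?_, ?_, ?_, ?_⟩
  · ext v
    simpa using hcl v
  · rw [Set.disjoint_left]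
    intro v h1 h2
    exact Lo_ne_Hi (Finset.mem_coe.mp h1) (Finset.mem_coe.mp h2) rfl
  · rw [Set.ncard_coe_finset]
    rw [← e3] at h2
    clear * - h2 h3
    generalize (Hi A).card = h at *
    generalize (Lo A).card = l at *
    subst h3
    have h4 : ((h : ℤ) - l - 2) ^ 2 ≤ 1 := by
      zify at h2
      nlinarith
    have h5 := abs_le.mp ((sq_le_one_iff_abs_le_one _).mp h4)
    omega
  · intro x hx y hy
    exact hLH x hx y hy
  · intro x hx y hy
    exact noLL x hx y hy
  · intro y hy
    rw [← f2 y hy]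
    unfold pp
    rw [← Set.ncard_coe_finset]
    congr 1
    ext z
    simp
  · intro u v huv
    rcases hcl u with h | h <;> rcases hcl v with h' | h'
    · exact absurd huv (noLL u h v h')
    · exact Or.inl ⟨h, h'⟩
    · exact absurd huv (hori _ _ (hLH v h' u h))
    · exact Or.inr ⟨h, h'⟩
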